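/- Range-based safe pruning for binary features (Theorem 8): assume all feature values are binary, x_{i,k} ∈ {0,1}. Let λ₀ > 0, let α₀* be a maximizer of D_{λ₀} over the nonnegative orthant, and let α₀ ≥ 0 satisfy ‖α₀ − α₀*‖₂ ≤ ε. For a feature index k define a := Σ_{i=1}^n max( Σ_{j∈D_i} (α₀)_j·x_{b_j,k} , x_{i,k}·(Σ_{j∈D_i} (α₀)_j − Σ_{j∈S_i} (α₀)_j·(1 − x_{b_j,k})) ) and b := sqrt(Σ_{j=1}^N max(x_{a_j,k}, x_{b_j,k})), and set λ′_a := λ₀·(2εb + ‖α₀‖₂·b + a) / (2λ₀ + ‖α₀‖₂·b − a). Then for every λ with λ′_a ≤ λ ≤ λ₀, every maximizer α_λ* of D_λ over the nonnegative orthant, and every descendant k′ of k, (m_λ(α_λ*))_{k′} = 0. -/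

import Mathlib

open Finset

/-- The matrix `C` with entries `C_{k,j} = σ_j · (x_{a_j,k} − x_{b_j,k})²`. -/
def pairC {n p N : ℕ} (x : Fin n → Fin p → ℝ) (sgn : Fin N → ℝ)
    (a b : Fin N → Fin n) : Matrix (Fin p) (Fin N) ℝ :=
  fun k j => sgn j * (x (a j) k - x (b j) k) ^ 2

/-- The vector `m_λ(α)` with `(m_λ(α))_k = (1/(λη)) · max((Cα)_k − λ, 0)`. -/
noncomputable def mLam {p N : ℕ} (C : Matrix (Fin p) (Fin N) ℝ) (lam eta : ℝ)
    (α : Fin N → ℝ) : Fin p → ℝ :=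
  fun k => (1 / (lam * eta)) * max ((∑ j, C k j * α j) - lam) 0

/-- The dual objective `D_λ(α)`. -/
noncomputable def dualObj {p N : ℕ} (C : Matrix (Fin p) (Fin N) ℝ) (t : Fin N → ℝ)
    (lam eta : ℝ) (α : Fin N → ℝ) : ℝ :=
  -(1 / 4) * (∑ j, α j ^ 2) + (∑ j, t j * α j)
    - lam * eta / 2 * ∑ k, mLam C lam eta α k ^ 2

/-- The binary-feature constant
`a := Σ_i max(Σ_{j∈D_i} (α₀)_j x_{b_j,k}, x_{i,k}(Σ_{j∈D_i} (α₀)_j − Σ_{j∈S_i} (α₀)_j (1 − x_{b_j,k})))`. -/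
noncomputable def binA {n p N : ℕ} (x : Fin n → Fin p → ℝ) (sgn : Fin N → ℝ)
    (a b : Fin N → Fin n) (k : Fin p) (α0 : Fin N → ℝ) : ℝ :=
  ∑ i : Fin n,
    max (∑ j ∈ Finset.univ.filter (fun j => sgn j = 1 ∧ a j = i), α0 j * x (b j) k)
      (x i k * ((∑ j ∈ Finset.univ.filter (fun j => sgn j = 1 ∧ a j = i), α0 j)
        - ∑ j ∈ Finset.univ.filter (fun j => sgn j = -1 ∧ a j = i), α0 j * (1 - x (b j) k)))

open scoped RealInnerProductSpace

/-- First-order optimality condition at a maximizer of a concave function minus `c‖·‖²`. -/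
lemma ConcaveOn.sub_le_inner_of_isMaxOn_sub_sq {E : Type*} [NormedAddCommGroup E]
    [InnerProductSpace ℝ E] {S : Set E} {f : E → ℝ} (hf : ConcaveOn ℝ S f) {c : ℝ} {x y : E}
    (hx : x ∈ S) (hy : y ∈ S) (hmax : IsMaxOn (fun z => f z - c * ‖z‖ ^ 2) S x) :
    f y - f x ≤ 2 * c * ⟪x, y - x⟫ := by
  have key : ∀ s : ℝ, 0 < s → s ≤ 1 →
      f y - f x ≤ 2 * c * ⟪x, y - x⟫ + s * (c * ‖y - x‖ ^ 2) := by
    intro s hs hs1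
    have hconc := hf.2 hx hy (sub_nonneg.2 hs1) hs.le (by ring)
    have hmem := hf.1 hx hy (sub_nonneg.2 hs1) hs.le (by ring)
    have heq : (1 - s) • x + s • y = x + s • (y - x) := by module
    rw [heq] at hconc hmem
    have h := hmax hmem
    simp only [Set.mem_ofPred_eq, smul_eq_mul] at h hconc
    rw [norm_add_sq_real, inner_smul_right, norm_smul, Real.norm_of_nonneg hs.le] at h
    refine le_of_mul_le_mul_left ?_ hs
    nlinarith
  have hlim : Filter.Tendsto (fun s : ℝ => 2 * c * ⟪x, y - x⟫ + s * (c * ‖y - x‖ ^ 2))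
      (nhdsWithin 0 (Set.Ioi 0)) (nhds (2 * c * ⟪x, y - x⟫)) := by
    have hcont : Continuous fun s : ℝ => 2 * c * ⟪x, y - x⟫ + s * (c * ‖y - x‖ ^ 2) := by
      fun_prop
    simpa using (hcont.tendsto 0).mono_left nhdsWithin_le_nhds
  refine ge_of_tendsto hlim ?_
  filter_upwards [Ioc_mem_nhdsGT (zero_lt_one (α := ℝ))] with s hs
  exact key s hs.1 hs.2

/-- Comparison of maximizers of the same concave function under two quadratic penalties. -/
lemma ConcaveOn.inner_le_zero_of_isMaxOn_sub_sq {E : Type*} [NormedAddCommGroup E]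
    [InnerProductSpace ℝ E] {S : Set E} {f : E → ℝ} (hf : ConcaveOn ℝ S f) {c d : ℝ} {x y : E}
    (hx : x ∈ S) (hy : y ∈ S) (hxmax : IsMaxOn (fun z => f z - c * ‖z‖ ^ 2) S x)
    (hymax : IsMaxOn (fun z => f z - d * ‖z‖ ^ 2) S y) :
    ⟪c • x - d • y, x - y⟫ ≤ 0 := by
  have h1 := hf.sub_le_inner_of_isMaxOn_sub_sq hx hy hxmax
  have h2 := hf.sub_le_inner_of_isMaxOn_sub_sq hy hx hymax
  simp only [inner_sub_left, inner_sub_right, real_inner_smul_left] at *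
  linarith

/-- A vector on the inner side of the sphere with diameter `y`, `r • y`. -/
lemma norm_sub_smul_le_of_inner_nonpos {E : Type*} [NormedAddCommGroup E]
    [InnerProductSpace ℝ E] {u y : E} {r : ℝ} (hr : r ≤ 1) (h : ⟪u - y, u - r • y⟫ ≤ 0) :
    ‖u - ((1 + r) / 2) • y‖ ≤ (1 - r) / 2 * ‖y‖ := by
  refine le_of_sq_le_sq ?_ (mul_nonneg (by linarith) (norm_nonneg y))
  rw [norm_sub_sq_real, norm_smul, mul_pow, mul_pow, Real.norm_eq_abs, sq_abs,
    real_inner_smul_right]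
  simp only [inner_sub_left, inner_sub_right, real_inner_smul_right,
    real_inner_self_eq_norm_sq, real_inner_comm u y] at h
  nlinarith

/-- The `λ`-independent concave part of the rescaled dual objective. -/
noncomputable def rescaledDual {p N : ℕ} (C : Matrix (Fin p) (Fin N) ℝ) (t : Fin N → ℝ)
    (eta : ℝ) (β : EuclideanSpace ℝ (Fin N)) : ℝ :=
  (∑ j, t j * β j) - 1 / (2 * eta) * ∑ k, max ((∑ j, C k j * β j) - 1) 0 ^ 2

lemma concaveOn_rescaledDual {p N : ℕ} (C : Matrix (Fin p) (Fin N) ℝ) (t : Fin N → ℝ)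
    {eta : ℝ} (heta : 0 < eta) :
    ConcaveOn ℝ {β : EuclideanSpace ℝ (Fin N) | ∀ j, 0 ≤ β j} (rescaledDual C t eta) := by
  refine ⟨fun x hx y hy r s hr hs _ j => ?_, fun x _ y _ r s hr hs hrs => ?_⟩
  · exact add_nonneg (mul_nonneg hr (hx j)) (mul_nonneg hs (hy j))
  have hlin : ∀ w : Fin N → ℝ, ∑ j, w j * (r • x + s • y) j
      = r * ∑ j, w j * x j + s * ∑ j, w j * y j := by
    intro w
    rw [mul_sum, mul_sum, ← sum_add_distrib]
    refine sum_congr rfl fun j _ => ?_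
    simp only [PiLp.add_apply, PiLp.smul_apply, smul_eq_mul]
    ring
  have hconv : ∀ k, max ((∑ j, C k j * (r • x + s • y) j) - 1) 0 ^ 2
      ≤ r * max ((∑ j, C k j * x j) - 1) 0 ^ 2 + s * max ((∑ j, C k j * y j) - 1) 0 ^ 2 := by
    intro k
    rw [hlin]
    set u := (∑ j, C k j * x j) - 1 with hu
    set v := (∑ j, C k j * y j) - 1 with hv
    have h1 : max (r * ∑ j, C k j * x j + s * ∑ j, C k j * y j - 1) 0
        ≤ r * max u 0 + s * max v 0 := by
      refine max_le ?_ (by positivity)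
      have := mul_le_mul_of_nonneg_left (le_max_left u 0) hr
      have := mul_le_mul_of_nonneg_left (le_max_left v 0) hs
      have : r * ∑ j, C k j * x j + s * ∑ j, C k j * y j - 1 = r * u + s * v := by
        rw [hu, hv]; linear_combination hrs
      linarith
    refine (pow_le_pow_left₀ (le_max_right _ _) h1 2).trans ?_
    simpa using (even_two.convexOn_pow (𝕜 := ℝ)).2 (Set.mem_univ (max u 0))
      (Set.mem_univ (max v 0)) hr hs hrs
  have hsum := sum_le_sum fun k (_ : k ∈ univ) => hconv k
  rw [sum_add_distrib, ← mul_sum, ← mul_sum] at hsum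
  have := mul_le_mul_of_nonneg_left hsum (by positivity : 0 ≤ 1 / (2 * eta))
  simp only [rescaledDual, smul_eq_mul]
  rw [hlin]
  linarith

lemma dualObj_smul {p N : ℕ} (C : Matrix (Fin p) (Fin N) ℝ) (t : Fin N → ℝ)
    {lam eta : ℝ} (hlam : 0 < lam) (heta : 0 < eta) (β : EuclideanSpace ℝ (Fin N)) :
    dualObj C t lam eta (fun j => lam * β j)
      = lam * (rescaledDual C t eta β - lam / 4 * ‖β‖ ^ 2) := by
  have hm : ∀ k, mLam C lam eta (fun j => lam * β j) k
      = 1 / eta * max ((∑ j, C k j * β j) - 1) 0 := by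
    intro k
    have h1 : (∑ j, C k j * (lam * β j)) - lam = lam * ((∑ j, C k j * β j) - 1) := by
      rw [mul_sub, mul_sum, mul_one]
      congr 1
      exact sum_congr rfl fun j _ => by ring
    have h2 := mul_max_of_nonneg ((∑ j, C k j * β j) - 1) 0 hlam.le
    rw [mul_zero] at h2
    rw [mLam, h1, ← h2]
    field_simp
  have hsq : ∑ j, (lam * β j) ^ 2 = lam ^ 2 * ‖β‖ ^ 2 := by
    rw [EuclideanSpace.real_norm_sq_eq, mul_sum]
    exact sum_congr rfl fun j _ => by ring
  have ht : ∑ j, t j * (lam * β j) = lam * ∑ j, t j * β j := by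
    rw [mul_sum]
    exact sum_congr rfl fun j _ => by ring
  simp only [dualObj, rescaledDual, hm, hsq, ht]
  simp only [mul_pow, ← mul_sum]
  field_simp
  ring

lemma isMaxOn_rescaledDual {p N : ℕ} {C : Matrix (Fin p) (Fin N) ℝ} {t : Fin N → ℝ}
    {lam eta : ℝ} (hlam : 0 < lam) (heta : 0 < eta) {α : Fin N → ℝ}
    (hα : IsMaxOn (dualObj C t lam eta) {α | ∀ j, 0 ≤ α j} α) :
    IsMaxOn (fun β => rescaledDual C t eta β - lam / 4 * ‖β‖ ^ 2)
      {β : EuclideanSpace ℝ (Fin N) | ∀ j, 0 ≤ β j} (lam⁻¹ • WithLp.toLp 2 α) := by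
  intro β hβ
  have h := hα (a := fun j => lam * β j) fun j => mul_nonneg hlam.le (hβ j)
  have hα' : α = fun j => lam * (lam⁻¹ • WithLp.toLp 2 α : EuclideanSpace ℝ (Fin N)) j := by
    funext j
    simp [hlam.ne']
  rw [Set.mem_ofPred_eq, hα', dualObj_smul C t hlam heta, dualObj_smul C t hlam heta] at h
  exact le_of_mul_le_mul_left h hlam

/-- Maximizers for `lam ≤ lam0` lie in a ball determined by an approximate maximizer for `lam0`. -/
lemma norm_sub_smul_le_of_isMaxOn_dualObj {p N : ℕ} {C : Matrix (Fin p) (Fin N) ℝ}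
    {t : Fin N → ℝ} {lam lam0 eta : ℝ} (heta : 0 < eta) (hlam : 0 < lam) (hle : lam ≤ lam0)
    {α0star α : Fin N → ℝ} (hα0star_nonneg : ∀ j, 0 ≤ α0star j) (hα_nonneg : ∀ j, 0 ≤ α j)
    (hα0star : IsMaxOn (dualObj C t lam0 eta) {α | ∀ j, 0 ≤ α j} α0star)
    (hα : IsMaxOn (dualObj C t lam eta) {α | ∀ j, 0 ≤ α j} α)
    (α0 : EuclideanSpace ℝ (Fin N)) {ε : ℝ} (hε : ‖α0 - WithLp.toLp 2 α0star‖ ≤ ε) :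
    ‖WithLp.toLp 2 α - ((1 + lam / lam0) / 2) • α0‖ ≤ (1 - lam / lam0) / 2 * ‖α0‖ + ε := by
  have hlam0 : 0 < lam0 := hlam.trans_le hle
  set u : EuclideanSpace ℝ (Fin N) := WithLp.toLp 2 α
  set y : EuclideanSpace ℝ (Fin N) := WithLp.toLp 2 α0star
  set r := lam / lam0 with hr
  have hr0 : 0 < r := div_pos hlam hlam0
  have hr1 : r ≤ 1 := (div_le_one hlam0).2 hle
  have hinner := (concaveOn_rescaledDual C t heta).inner_le_zero_of_isMaxOn_sub_sq
    (fun j => mul_nonneg (inv_nonneg.2 hlam.le) (hα_nonneg j))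
    (fun j => mul_nonneg (inv_nonneg.2 hlam0.le) (hα0star_nonneg j))
    (isMaxOn_rescaledDual hlam heta hα) (isMaxOn_rescaledDual hlam0 heta hα0star)
  have e1 : (lam / 4) • lam⁻¹ • u - (lam0 / 4) • lam0⁻¹ • y = (1 / 4 : ℝ) • (u - y) := by
    rw [smul_smul, smul_smul, smul_sub]
    congr 2 <;> field_simp
  have e2 : lam⁻¹ • u - lam0⁻¹ • y = lam⁻¹ • (u - r • y) := by
    rw [smul_sub, smul_smul]
    congr 2
    rw [hr]; field_simp
  rw [e1, e2, real_inner_smul_left, real_inner_smul_right] at hinner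
  have hsphere : ⟪u - y, u - r • y⟫ ≤ 0 := by
    by_contra! hpos
    have : 0 < 1 / 4 * (lam⁻¹ * ⟪u - y, u - r • y⟫) := by positivity
    linarith
  have hball := norm_sub_smul_le_of_inner_nonpos hr1 hsphere
  have hy : ‖y‖ ≤ ‖α0‖ + ε := by
    have := norm_sub_norm_le y α0
    rw [norm_sub_rev] at this
    linarith
  have hy' := mul_le_mul_of_nonneg_left hy (by linarith : 0 ≤ (1 - r) / 2)
  have hcenter : ‖((1 + r) / 2) • (α0 - y)‖ ≤ (1 + r) / 2 * ε := by
    rw [norm_smul, Real.norm_of_nonneg (by linarith)]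
    exact mul_le_mul_of_nonneg_left hε (by linarith)
  have htri := norm_sub_le (u - ((1 + r) / 2) • y) (((1 + r) / 2) • (α0 - y))
  have e3 : u - ((1 + r) / 2) • y - ((1 + r) / 2) • (α0 - y) = u - ((1 + r) / 2) • α0 := by
    module
  rw [e3] at htri
  linarith

lemma sum_filter_sign_add {n N : ℕ} {sgn : Fin N → ℝ} (hsgn : ∀ j, sgn j = 1 ∨ sgn j = -1)
    (a : Fin N → Fin n) (f : Fin N → ℝ) :
    ∑ j, f j = ∑ i, ((∑ j ∈ univ.filter (fun j => sgn j = 1 ∧ a j = i), f j)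
      + ∑ j ∈ univ.filter (fun j => sgn j = -1 ∧ a j = i), f j) := by
  rw [← sum_fiberwise univ a f]
  refine sum_congr rfl fun i _ => ?_
  simp only [sum_filter, ← sum_add_distrib]
  refine sum_congr rfl fun j _ => ?_
  rcases hsgn j with h | h <;> norm_num [h]

lemma sum_pairC_mul_le_binA {n p N : ℕ} {x : Fin n → Fin p → ℝ}
    (hbin : ∀ i k, x i k = 0 ∨ x i k = 1) {sgn : Fin N → ℝ}
    (hsgn : ∀ j, sgn j = 1 ∨ sgn j = -1) (a b : Fin N → Fin n) {α : Fin N → ℝ}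
    (hα : ∀ j, 0 ≤ α j) {k k' : Fin p} (hk : ∀ i, x i k' ≤ x i k) :
    ∑ j, pairC x sgn a b k' j * α j ≤ binA x sgn a b k α := by
  rw [sum_filter_sign_add hsgn a, binA]
  refine sum_le_sum fun i _ => ?_
  rcases hbin i k' with h0 | h1
  · refine le_max_of_le_left ?_
    have hD : ∑ j ∈ univ.filter (fun j => sgn j = 1 ∧ a j = i), pairC x sgn a b k' j * α j
        ≤ ∑ j ∈ univ.filter (fun j => sgn j = 1 ∧ a j = i), α j * x (b j) k := by
      refine sum_le_sum fun j hj => ?_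
      obtain ⟨hs, ha⟩ := (mem_filter.1 hj).2
      have := mul_le_mul_of_nonneg_left (hk (b j)) (hα j)
      rcases hbin (b j) k' with h | h <;> simp only [pairC, hs, ha, h0, h] at * <;> linarith
    have hS : ∑ j ∈ univ.filter (fun j => sgn j = -1 ∧ a j = i), pairC x sgn a b k' j * α j
        ≤ 0 := by
      refine sum_nonpos fun j hj => ?_
      rw [pairC, (mem_filter.1 hj).2.1]
      have := mul_nonneg (sq_nonneg (x (a j) k' - x (b j) k')) (hα j)
      linarith
    linarith
  · refine le_max_of_le_right ?_
    have hik : x i k = 1 := by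
      have := hk i
      rcases hbin i k with h | h <;> linarith
    rw [hik, one_mul, sub_eq_add_neg, ← sum_neg_distrib]
    refine add_le_add (sum_le_sum fun j hj => ?_) (sum_le_sum fun j hj => ?_)
    · obtain ⟨hs, ha⟩ := (mem_filter.1 hj).2
      have := hα j
      rcases hbin (b j) k' with h | h <;> simp only [pairC, hs, ha, h1, h] at * <;> linarith
    · obtain ⟨hs, ha⟩ := (mem_filter.1 hj).2
      have := mul_le_mul_of_nonneg_left (hk (b j)) (hα j)
      rcases hbin (b j) k' with h | h <;> simp only [pairC, hs, ha, h1, h] at * <;> linarith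

lemma binA_le_sum_max {n p N : ℕ} {x : Fin n → Fin p → ℝ} (hx : ∀ i k, 0 ≤ x i k)
    (hx1 : ∀ i k, x i k ≤ 1)
    {sgn : Fin N → ℝ} (hsgn : ∀ j, sgn j = 1 ∨ sgn j = -1) (a b : Fin N → Fin n)
    (k : Fin p) {α : Fin N → ℝ} (hα : ∀ j, 0 ≤ α j) :
    binA x sgn a b k α ≤ ∑ j, max (x (a j) k) (x (b j) k) * α j := by
  rw [sum_filter_sign_add hsgn a, binA]
  refine sum_le_sum fun i _ => ?_
  have hS : 0 ≤ ∑ j ∈ univ.filter (fun j => sgn j = -1 ∧ a j = i),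
      max (x (a j) k) (x (b j) k) * α j :=
    sum_nonneg fun j _ => mul_nonneg (le_max_of_le_left (hx _ _)) (hα j)
  have hS' : 0 ≤ ∑ j ∈ univ.filter (fun j => sgn j = -1 ∧ a j = i), α j * (1 - x (b j) k) :=
    sum_nonneg fun j _ => mul_nonneg (hα j) (sub_nonneg.2 (hx1 _ _))
  refine max_le (le_add_of_le_of_nonneg (sum_le_sum fun j _ => ?_) hS)
    (le_add_of_le_of_nonneg ?_ hS)
  · rw [mul_comm]
    exact mul_le_mul_of_nonneg_right (le_max_right _ _) (hα j)
  · rw [mul_sub]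
    refine (sub_le_self _ (mul_nonneg (hx i k) hS')).trans ?_
    rw [mul_sum]
    refine sum_le_sum fun j hj => mul_le_mul_of_nonneg_right ?_ (hα j)
    rw [(mem_filter.1 hj).2.2]
    exact le_max_left _ _

lemma sum_mul_eq_inner {N : ℕ} (v w : Fin N → ℝ) :
    ∑ j, v j * w j = ⟪(WithLp.toLp 2 v : EuclideanSpace ℝ (Fin N)), WithLp.toLp 2 w⟫ := by
  simp [PiLp.inner_apply, mul_comm]

lemma norm_pairC_row_le {n p N : ℕ} {x : Fin n → Fin p → ℝ}
    (hbin : ∀ i k, x i k = 0 ∨ x i k = 1) {sgn : Fin N → ℝ}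
    (hsgn : ∀ j, sgn j = 1 ∨ sgn j = -1) (a b : Fin N → Fin n) {k k' : Fin p}
    (hk : ∀ i, x i k' ≤ x i k) :
    ‖(WithLp.toLp 2 (pairC x sgn a b k') : EuclideanSpace ℝ (Fin N))‖
      ≤ √(∑ j, max (x (a j) k) (x (b j) k)) := by
  rw [EuclideanSpace.norm_eq]
  refine Real.sqrt_le_sqrt (sum_le_sum fun j _ => ?_)
  refine le_trans ?_ (max_le_max (hk (a j)) (hk (b j)))
  rcases hsgn j with hs | hs <;> rcases hbin (a j) k' with h | h <;>
    rcases hbin (b j) k' with h' | h' <;> norm_num [pairC, hs, h, h']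

/-- Range-based safe pruning for binary features (Theorem 8): assuming all feature
values are binary, with `a := binA`, `b := sqrt(Σ_j max(x_{a_j,k}, x_{b_j,k}))` and
`λ′_a := λ₀(2εb + ‖α₀‖b + a)/(2λ₀ + ‖α₀‖b − a)`, for every `λ ∈ [λ′_a, λ₀]`, every
maximizer `α_λ*` of `D_λ` over the nonnegative orthant, and every descendant `k′`
of `k`, `(m_λ(α_λ*))_{k′} = 0`. -/
theorem igml_range_safe_pruning_binary {n p N : ℕ}
    (x : Fin n → Fin p → ℝ) (hbin : ∀ i k, x i k = 0 ∨ x i k = 1)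
    (sgn : Fin N → ℝ) (hsgn : ∀ j, sgn j = 1 ∨ sgn j = -1)
    (a b : Fin N → Fin n) (t : Fin N → ℝ)
    (eta : ℝ) (heta : 0 < eta)
    (lam0 : ℝ) (hlam0 : 0 < lam0)
    (α0star : Fin N → ℝ) (hα0star_nonneg : ∀ j, 0 ≤ α0star j)
    (hα0star : IsMaxOn (dualObj (pairC x sgn a b) t lam0 eta) {α | ∀ j, 0 ≤ α j} α0star)
    (α0 : Fin N → ℝ) (hα0_nonneg : ∀ j, 0 ≤ α0 j) (ε : ℝ)
    (hε : Real.sqrt (∑ j, (α0 j - α0star j) ^ 2) ≤ ε)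
    (k : Fin p) :
    ∀ lam : ℝ, 0 < lam →
      lam0 * (2 * ε * Real.sqrt (∑ j, max (x (a j) k) (x (b j) k))
            + Real.sqrt (∑ j, α0 j ^ 2) * Real.sqrt (∑ j, max (x (a j) k) (x (b j) k))
            + binA x sgn a b k α0)
          / (2 * lam0
            + Real.sqrt (∑ j, α0 j ^ 2) * Real.sqrt (∑ j, max (x (a j) k) (x (b j) k))
            - binA x sgn a b k α0) ≤ lam →
      lam ≤ lam0 →
      ∀ αlamstar : Fin N → ℝ, (∀ j, 0 ≤ αlamstar j) →
        IsMaxOn (dualObj (pairC x sgn a b) t lam eta) {α | ∀ j, 0 ≤ α j} αlamstar →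
        ∀ k' : Fin p, (∀ i, x i k' ≤ x i k) →
          mLam (pairC x sgn a b) lam eta αlamstar k' = 0 := by
  intro lam hlam hlow hle α hα_nonneg hα k' hk
  set A := binA x sgn a b k α0
  set B := √(∑ j, max (x (a j) k) (x (b j) k)) with hB
  set u : EuclideanSpace ℝ (Fin N) := WithLp.toLp 2 α0
  set w : EuclideanSpace ℝ (Fin N) := WithLp.toLp 2 (pairC x sgn a b k')
  set v : EuclideanSpace ℝ (Fin N) := WithLp.toLp 2 α
  have hnorm : √(∑ j, α0 j ^ 2) = ‖u‖ := by simp [u, EuclideanSpace.norm_eq]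
  rw [hnorm] at hlow
  have hx0 : ∀ i k, 0 ≤ x i k := fun i k => by rcases hbin i k with h | h <;> norm_num [h]
  have hx1 : ∀ i k, x i k ≤ 1 := fun i k => by rcases hbin i k with h | h <;> norm_num [h]
  have hA : A ≤ ‖u‖ * B := by
    refine (binA_le_sum_max hx0 hx1 hsgn a b k hα0_nonneg).trans ?_
    rw [sum_mul_eq_inner, mul_comm]
    refine (real_inner_le_norm _ _).trans (mul_le_mul_of_nonneg_right ?_ (norm_nonneg u))
    rw [EuclideanSpace.norm_eq, hB]
    refine Real.sqrt_le_sqrt (sum_le_sum fun j _ => ?_)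
    rcases hbin (a j) k with h | h <;> rcases hbin (b j) k with h' | h' <;> norm_num [h, h']
  have hball := norm_sub_smul_le_of_isMaxOn_dualObj heta hlam hle hα0star_nonneg hα_nonneg
    hα0star hα u (ε := ε) (by simpa [u, EuclideanSpace.norm_eq] using hε)
  have hcenter : ⟪w, u⟫ ≤ A := by
    rw [← sum_mul_eq_inner]
    exact sum_pairC_mul_le_binA hbin hsgn a b hα0_nonneg hk
  have hrow : ‖w‖ ≤ B := norm_pairC_row_le hbin hsgn a b hk
  set r := lam / lam0
  have hr0 : 0 < r := div_pos hlam hlam0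
  have hlamr : lam = lam0 * r := by simp only [r]; field_simp
  have hdev : ⟪w, v - ((1 + r) / 2) • u⟫ ≤ B * ((1 - r) / 2 * ‖u‖ + ε) :=
    (real_inner_le_norm _ _).trans
      (mul_le_mul hrow hball (norm_nonneg _) (Real.sqrt_nonneg _))
  rw [inner_sub_right, real_inner_smul_right] at hdev
  have hscaled := mul_le_mul_of_nonneg_left hcenter (by linarith : 0 ≤ (1 + r) / 2)
  rw [div_le_iff₀ (by linarith), hlamr, mul_assoc lam0 r] at hlow
  have hlow' := le_of_mul_le_mul_left hlow hlam0
  have hfinal : ∑ j, pairC x sgn a b k' j * α j ≤ lam := by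
    rw [sum_mul_eq_inner]
    linarith
  rw [mLam, max_eq_right (sub_nonpos.2 hfinal), mul_zero]
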